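/- arXiv:1412.5714 — 3 statements merged into one kernel-verified Lean document; each statement's English description precedes it below -/
import Mathlib

section
/- Let R be a commutative ring. Then R is J-stable if and only if the following holds: for every n ≥ 3 and all a₁, …, aₙ ∈ R with a₁R + ⋯ + aₙR = R and such that the ideal generated by a₁, …, a_{n−2} is not contained in J(R), there exists b ∈ R such that a₁R + ⋯ + a_{n−2}R + (a_{n−1} + aₙb)R = R. -/
/-- A commutative ring has stable range 1 if whenever `aR + bR = R`,
there exists `y` such that `a + b * y` is a unit. -/
def StableRange1 (R : Type*) [CommRing R] : Prop :=
  ∀ a b : R, Ideal.span {a} ⊔ Ideal.span {b} = ⊤ → ∃ y : R, IsUnit (a + b * y)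

/-- A commutative ring is J-stable if `R/aR` has stable range 1 for every
`a` not in the Jacobson radical. -/
def JStable (R : Type*) [CommRing R] : Prop :=
  ∀ a : R, a ∉ Ideal.jacobson (⊥ : Ideal R) → StableRange1 (R ⧸ Ideal.span {a})

theorem Ideal.Quotient.isUnit_mk_iff_sup_span_singleton_eq_top {R : Type*} [CommRing R]
    (I : Ideal R) (x : R) :
    IsUnit (Ideal.Quotient.mk I x) ↔ I ⊔ Ideal.span {x} = ⊤ := by
  rw [sup_comm, Ideal.eq_top_iff_one, Submodule.mem_sup]
  constructor
  · intro h
    obtain ⟨v, hv⟩ := isUnit_iff_exists_inv.mp h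
    obtain ⟨u, rfl⟩ := Ideal.Quotient.mk_surjective v
    refine ⟨x * u, Ideal.mul_mem_right _ _ (Ideal.mem_span_singleton_self x), 1 - x * u, ?_,
      by ring⟩
    rw [← Ideal.Quotient.eq_zero_iff_mem, map_sub, map_mul, map_one, hv, sub_self]
  · rintro ⟨y, hy, i, hi, hyi⟩
    obtain ⟨u, rfl⟩ := Ideal.mem_span_singleton'.mp hy
    refine isUnit_iff_exists_inv.mpr ⟨Ideal.Quotient.mk I u, ?_⟩
    have h := congrArg (Ideal.Quotient.mk I) hyi
    rw [map_add, Ideal.Quotient.eq_zero_iff_mem.mpr hi, add_zero, map_mul, map_one] at h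
    rw [mul_comm, h]

theorem Ideal.Quotient.span_mk_sup_span_mk_eq_top_iff {R : Type*} [CommRing R]
    (I : Ideal R) (c d : R) :
    Ideal.span {Ideal.Quotient.mk I c} ⊔ Ideal.span {Ideal.Quotient.mk I d} = ⊤ ↔
      I ⊔ (Ideal.span {c} ⊔ Ideal.span {d}) = ⊤ := by
  have hmap : Ideal.span {Ideal.Quotient.mk I c} ⊔ Ideal.span {Ideal.Quotient.mk I d} =
      (Ideal.span {c} ⊔ Ideal.span {d}).map (Ideal.Quotient.mk I) := by
    rw [Ideal.map_sup, Ideal.map_span, Ideal.map_span, Set.image_singleton, Set.image_singleton]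
  have hcomap : ((Ideal.span {c} ⊔ Ideal.span {d}).map (Ideal.Quotient.mk I)).comap
      (Ideal.Quotient.mk I) = I ⊔ (Ideal.span {c} ⊔ Ideal.span {d}) := by
    rw [Ideal.comap_map_of_surjective' _ Ideal.Quotient.mk_surjective, Ideal.mk_ker, sup_comm]
  rw [hmap, ← hcomap, Ideal.comap_eq_top_iff]

theorem stableRange1_quotient_iff {R : Type*} [CommRing R] (I : Ideal R) :
    StableRange1 (R ⧸ I) ↔
      ∀ c d : R, I ⊔ (Ideal.span {c} ⊔ Ideal.span {d}) = ⊤ →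
        ∃ y : R, I ⊔ Ideal.span {c + d * y} = ⊤ := by
  simp only [StableRange1, Ideal.Quotient.mk_surjective.forall, Ideal.Quotient.mk_surjective.exists,
    Ideal.Quotient.span_mk_sup_span_mk_eq_top_iff, ← map_mul, ← map_add,
    Ideal.Quotient.isUnit_mk_iff_sup_span_singleton_eq_top]

theorem StableRange1.quotient_of_le {R : Type*} [CommRing R] {I K : Ideal R} (hIK : I ≤ K)
    (h : StableRange1 (R ⧸ I)) : StableRange1 (R ⧸ K) := by
  rw [stableRange1_quotient_iff] at h ⊢
  intro c d hcd
  rw [Ideal.eq_top_iff_one, Submodule.mem_sup] at hcd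
  obtain ⟨k, hk, z, hz, hkz⟩ := hcd
  obtain ⟨p, hp, q, hq, rfl⟩ := Submodule.mem_sup.mp hz
  obtain ⟨s, rfl⟩ := Ideal.mem_span_singleton'.mp hq
  have hc : p ∈ Ideal.span {c} ⊔ Ideal.span {s * d + k} := Ideal.mem_sup_left hp
  have hd : s * d + k ∈ Ideal.span {c} ⊔ Ideal.span {s * d + k} :=
    Ideal.mem_sup_right (Ideal.mem_span_singleton_self _)
  obtain ⟨y, hy⟩ := h c (s * d + k) <| by
    rw [Ideal.eq_top_iff_one]
    refine Ideal.mem_sup_right ?_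
    have h1 : (1 : R) = p + (s * d + k) := by rw [← hkz]; ring
    exact h1 ▸ add_mem hc hd
  refine ⟨s * y, top_le_iff.mp (hy ▸ sup_le (hIK.trans le_sup_left) ?_)⟩
  rw [Ideal.span_singleton_le_iff_mem]
  have h2 : c + (s * d + k) * y = k * y + (c + d * (s * y)) := by ring
  rw [h2]
  exact add_mem (Ideal.mem_sup_left (K.mul_mem_right _ hk))
    (Ideal.mem_sup_right (Ideal.mem_span_singleton_self _))

theorem jstable_iff_bring (R : Type*) [CommRing R] :
    JStable R ↔
      ∀ (n : ℕ) (hn : 3 ≤ n) (a : Fin n → R),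
        Ideal.span (Set.range a) = ⊤ →
        ¬ (Ideal.span (a '' {i : Fin n | (i : ℕ) < n - 2}) ≤
            Ideal.jacobson (⊥ : Ideal R)) →
        ∃ b : R,
          Ideal.span (a '' {i : Fin n | (i : ℕ) < n - 2}) ⊔
            Ideal.span {a ⟨n - 2, by omega⟩ + a ⟨n - 1, by omega⟩ * b} = ⊤ := by
  constructor
  · intro hR n hn a ha hJ
    rw [Ideal.span_le, Set.not_subset] at hJ
    obtain ⟨x, hx, hxJ⟩ := hJ
    refine (stableRange1_quotient_iff _).mp ((hR x hxJ).quotient_of_le ?_) _ _ ?_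
    · exact Ideal.span_mono (Set.singleton_subset_iff.mpr hx)
    · rw [← top_le_iff, ← ha, Ideal.span_le]
      rintro _ ⟨i, rfl⟩
      by_cases hi : (i : ℕ) < n - 2
      · exact Ideal.mem_sup_left (Ideal.subset_span ⟨i, hi, rfl⟩)
      · refine Ideal.mem_sup_right ?_
        obtain h | h : i = ⟨n - 2, by omega⟩ ∨ i = ⟨n - 1, by omega⟩ := by
          simp only [Fin.ext_iff]
          omega
        · exact Ideal.mem_sup_left (h ▸ Ideal.mem_span_singleton_self _)
        · exact Ideal.mem_sup_right (h ▸ Ideal.mem_span_singleton_self _)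
  · intro h x hx
    rw [stableRange1_quotient_iff]
    intro c d hcd
    have himage : ![x, c, d] '' {i : Fin 3 | (i : ℕ) < 3 - 2} = {x} := by
      have hset : {i : Fin 3 | (i : ℕ) < 3 - 2} = {0} := by
        ext i
        exact Nat.lt_one_iff.trans Fin.val_eq_zero_iff
      rw [hset, Set.image_singleton]
      rfl
    have key := h 3 le_rfl ![x, c, d]
    rw [himage, Ideal.span_singleton_le_iff_mem] at key
    refine key ?_ hx
    rw [← top_le_iff, ← hcd]
    refine sup_le ?_ (sup_le ?_ ?_) <;> rw [Ideal.span_singleton_le_iff_mem]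
    · exact Ideal.subset_span ⟨0, rfl⟩
    · exact Ideal.subset_span ⟨1, rfl⟩
    · exact Ideal.subset_span ⟨2, rfl⟩
end

section
/- Let R be a commutative ring and let I be an ideal of R with I ⊆ J(R). Then R is J-stable if and only if R/I is J-stable. -/
theorem Ideal.isUnit_mk_span_singleton_iff {R : Type*} [CommRing R] (a z : R) :
    IsUnit (Ideal.Quotient.mk (Ideal.span {a}) z) ↔ IsCoprime z a := by
  rw [isUnit_iff_exists_inv]
  constructor
  · rintro ⟨w, hw⟩
    obtain ⟨w, rfl⟩ := Ideal.Quotient.mk_surjective w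
    rw [← map_mul, ← map_one (Ideal.Quotient.mk (Ideal.span {a})), Ideal.Quotient.eq,
      Ideal.mem_span_singleton] at hw
    obtain ⟨c, hc⟩ := hw
    exact ⟨w, -c, by linear_combination hc⟩
  · rintro ⟨u, v, h⟩
    refine ⟨Ideal.Quotient.mk _ u, ?_⟩
    rw [← map_mul, ← map_one (Ideal.Quotient.mk (Ideal.span {a})), Ideal.Quotient.eq,
      Ideal.mem_span_singleton]
    exact ⟨-v, by linear_combination h⟩

theorem stableRange1_quotient_span_singleton_iff {R : Type*} [CommRing R] (a : R) :
    StableRange1 (R ⧸ Ideal.span {a}) ↔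
      ∀ x b : R, (∃ u v : R, IsCoprime (u * x + v * b) a) → ∃ y, IsCoprime (x + b * y) a := by
  simp only [StableRange1, ← Ideal.isCoprime_iff_sup_eq, Ideal.isCoprime_span_singleton_iff,
    Ideal.Quotient.mk_surjective.forall, Ideal.Quotient.mk_surjective.exists, ← map_mul,
    ← map_add, Ideal.isUnit_mk_span_singleton_iff]
  refine forall₂_congr fun x b => imp_congr_left ⟨?_, ?_⟩
  · rintro ⟨u, v, h⟩
    obtain ⟨u, rfl⟩ := Ideal.Quotient.mk_surjective u
    obtain ⟨v, rfl⟩ := Ideal.Quotient.mk_surjective v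
    refine ⟨u, v, (Ideal.isUnit_mk_span_singleton_iff a _).1 ?_⟩
    rw [map_add, map_mul, map_mul, h]
    exact isUnit_one
  · rintro ⟨u, v, s, t, h⟩
    refine ⟨Ideal.Quotient.mk _ (s * u), Ideal.Quotient.mk _ (s * v), ?_⟩
    rw [← map_mul, ← map_mul, ← map_add, ← map_one (Ideal.Quotient.mk (Ideal.span {a})),
      Ideal.Quotient.eq, Ideal.mem_span_singleton]
    exact ⟨-t, by linear_combination h⟩

section LocalHom

variable {R S : Type*} [CommRing R] [CommRing S] (f : R →+* S) [IsLocalHom f]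

theorem isCoprime_map_iff_of_surjective (hf : Function.Surjective f) (x y : R) :
    IsCoprime (f x) (f y) ↔ IsCoprime x y := by
  refine ⟨?_, fun h => h.map f⟩
  rintro ⟨u, v, h⟩
  obtain ⟨u, rfl⟩ := hf u
  obtain ⟨v, rfl⟩ := hf v
  rw [← map_mul, ← map_mul, ← map_add] at h
  obtain ⟨w, hw⟩ := (isUnit_of_map_unit f _ (h ▸ isUnit_one)).exists_left_inv
  exact ⟨w * u, w * v, by linear_combination hw⟩

theorem map_mem_jacobson_bot_iff_of_surjective (hf : Function.Surjective f) (a : R) :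
    f a ∈ Ideal.jacobson (⊥ : Ideal S) ↔ a ∈ Ideal.jacobson (⊥ : Ideal R) := by
  simp only [Ideal.mem_jacobson_bot, hf.forall, ← map_mul, ← map_one f, ← map_add,
    isUnit_map_iff]

theorem jStable_iff_of_surjective (hf : Function.Surjective f) : JStable R ↔ JStable S := by
  simp only [JStable, stableRange1_quotient_span_singleton_iff, hf.forall, hf.exists, ← map_mul,
    ← map_add, isCoprime_map_iff_of_surjective f hf, map_mem_jacobson_bot_iff_of_surjective f hf]

end LocalHom

theorem jstable_iff_quotient (R : Type*) [CommRing R] (I : Ideal R)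
    (hI : I ≤ Ideal.jacobson (⊥ : Ideal R)) :
    JStable R ↔ JStable (R ⧸ I) := by
  have := isLocalHom_of_le_jacobson_bot I hI
  exact jStable_iff_of_surjective (Ideal.Quotient.mk I) Ideal.Quotient.mk_surjective
end

section
/- Every J-adequate ring is J-stable. -/
/-- An element `a` of a commutative ring is adequate if for every `b` there exist
`r, s` with `a = r * s`, `rR + bR = R`, and `s'R + bR ≠ R` for every non-unit
divisor `s'` of `s`. -/
def Adequate {R : Type*} [CommRing R] (a : R) : Prop :=
  ∀ b : R, ∃ r s : R, a = r * s ∧ Ideal.span {r} ⊔ Ideal.span {b} = ⊤ ∧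
    ∀ s' : R, ¬ IsUnit s' → s' ∣ s → Ideal.span {s'} ⊔ Ideal.span {b} ≠ ⊤

/-- A Bézout ring is J-adequate if every element not in the Jacobson radical
is adequate. -/
def JAdequate (R : Type*) [CommRing R] : Prop :=
  IsBezout R ∧ ∀ a : R, a ∉ Ideal.jacobson (⊥ : Ideal R) → Adequate a

theorem span_sup_span_eq_top_iff_isCoprime {R : Type*} [CommRing R] (a b : R) :
    Ideal.span {a} ⊔ Ideal.span {b} = ⊤ ↔ IsCoprime a b := by
  rw [← Ideal.isCoprime_span_singleton_iff, Ideal.isCoprime_iff_sup_eq]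

/-- In a Bézout ring, the quotient by an adequate element has stable range 1. -/
theorem Adequate.stableRange1_quotient {R : Type*} [CommRing R] [IsBezout R] {a : R}
    (ha : Adequate a) : StableRange1 (R ⧸ Ideal.span {a}) := by
  intro b' c' h
  obtain ⟨b, rfl⟩ := Ideal.Quotient.mk_surjective b'
  obtain ⟨c, rfl⟩ := Ideal.Quotient.mk_surjective c'
  obtain ⟨u', v', huv⟩ := (span_sup_span_eq_top_iff_isCoprime _ _).1 h
  obtain ⟨u, rfl⟩ := Ideal.Quotient.mk_surjective u'
  obtain ⟨v, rfl⟩ := Ideal.Quotient.mk_surjective v'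
  rw [← map_mul, ← map_mul, ← map_add, ← map_one (Ideal.Quotient.mk (Ideal.span {a})),
    Ideal.Quotient.eq, Ideal.mem_span_singleton] at huv
  obtain ⟨w, hw⟩ := huv
  obtain ⟨r, s, hrs, hrb, hs⟩ := ha b
  obtain ⟨p, q, hpq⟩ := (span_sup_span_eq_top_iff_isCoprime _ _).1 hrb
  have hr : IsCoprime (b + c * r) r := ⟨q, p - q * c, by linear_combination hpq⟩
  have hs' : IsCoprime (b + c * r) s := by
    refine IsRelPrime.isCoprime fun d ⟨k, hk⟩ hds => ?_
    by_contra hd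
    refine hs d hd hds ((span_sup_span_eq_top_iff_isCoprime _ _).2 ?_)
    obtain ⟨l, hl⟩ := hds
    -- Modulo `d` and `b` we have `c = p * (c * r) = 0` and `a = r * s = 0`.
    refine ⟨v * p * k - w * r * l, u + v * c * q - v * p, ?_⟩
    linear_combination hw - v * p * hk + w * r * hl + w * hrs + v * c * hpq
  obtain ⟨x, z, hxz⟩ := hr.mul_right hs'
  refine ⟨Ideal.Quotient.mk _ r, IsUnit.of_mul_eq_one (Ideal.Quotient.mk _ x) ?_⟩
  rw [← map_mul, ← map_add, ← map_mul, ← map_one (Ideal.Quotient.mk (Ideal.span {a})),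
    Ideal.Quotient.eq, Ideal.mem_span_singleton]
  exact ⟨-z, by linear_combination hxz + z * hrs⟩

theorem jAdequate_jstable (R : Type*) [CommRing R] (h : JAdequate R) :
    JStable R := by
  obtain ⟨_, hR⟩ := h
  exact fun a ha => (hR a ha).stableRange1_quotient
end
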